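/- Every MN3P5 graph that is not isomorphic to the complete graph K4 contains a 5-hole (an induced cycle on five vertices). -/

import Mathlib

open SimpleGraph

/-- Build a simple graph on `Fin n` from a list of edges (symmetrized, loops removed). -/
def graphOfList {n : ℕ} (l : List (Fin n × Fin n)) : SimpleGraph (Fin n) :=
  SimpleGraph.fromRel (fun a b => (a, b) ∈ l)

/-- `K4`: the complete graph on four vertices. -/
def graphK4 : SimpleGraph (Fin 4) := ⊤

/-- `W5`: a 5-cycle `0,1,2,3,4` plus a hub `5` adjacent to all cycle vertices. -/
def graphW5 : SimpleGraph (Fin 6) :=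
  graphOfList [(0,1),(1,2),(2,3),(3,4),(4,0),(5,0),(5,1),(5,2),(5,3),(5,4)]

/-- `S1`: 5-cycle `v1..v5 = 0..4`, `u2 = 5` adjacent exactly to `v1,v2,v3`,
`u5 = 6` adjacent exactly to `v1,v4,v5`. -/
def graphS1 : SimpleGraph (Fin 7) :=
  graphOfList [(0,1),(1,2),(2,3),(3,4),(4,0),(5,0),(5,1),(5,2),(6,0),(6,3),(6,4)]

/-- `S2`: 5-cycle `v1..v5 = 0..4`, `w = 5` adjacent exactly to `v2,v3,v4,v5`,
`x = 6` adjacent exactly to `v1,v3,v4`. -/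
def graphS2 : SimpleGraph (Fin 7) :=
  graphOfList [(0,1),(1,2),(2,3),(3,4),(4,0),(5,1),(5,2),(5,3),(5,4),(6,0),(6,2),(6,3)]

/-- `T`: vertices `u1,uA,uB,u2 = 0,1,2,3`, `w1,wA,wB,w2 = 4,5,6,7`, `x1,x2 = 8,9`. -/
def graphT : SimpleGraph (Fin 10) :=
  graphOfList [(0,1),(0,2),(1,2),(1,3),(2,3),
               (4,5),(4,6),(5,6),(5,7),(6,7),
               (0,4),(0,7),(3,4),(3,7),(1,5),(2,6),
               (8,0),(8,2),(8,4),(8,5),(8,9),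
               (9,1),(9,3),(9,6),(9,7)]

/-- `B`: vertices `w = 0`, `u0..u5 = 1..6`, `v0..v5 = 7..12`, with its 39 edges. -/
def graphB : SimpleGraph (Fin 13) :=
  graphOfList [(0,2),(0,3),(0,6),(0,8),(0,9),(0,12),
               (1,2),(1,3),(1,4),(1,6),(1,8),(1,12),
               (2,3),(2,4),(2,5),(2,7),
               (3,9),(3,10),(3,11),
               (4,6),(4,9),(4,10),(4,11),
               (5,6),(5,9),(5,10),(5,11),(5,12),
               (6,7),(6,11),
               (7,8),(7,9),(7,10),(7,12),
               (8,9),(8,10),(8,11),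
               (10,12),(11,12)]

/-- `G` contains an induced copy of the path `P5` on five vertices. -/
def HasInducedP5 {V : Type*} (G : SimpleGraph V) : Prop :=
  ∃ f : Fin 5 ↪ V, ∀ a b : Fin 5, (SimpleGraph.pathGraph 5).Adj a b ↔ G.Adj (f a) (f b)

/-- `G` is `P5`-free: it has no induced subgraph isomorphic to `P5`. -/
def P5Free {V : Type*} (G : SimpleGraph V) : Prop := ¬ HasInducedP5 G

/-- `G` is an MN3P5 graph: `P5`-free, not 3-colorable, and every proper subgraph
is 3-colorable or contains an induced `P5`. -/
def IsMN3P5 {V : Type*} (G : SimpleGraph V) : Prop :=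
  P5Free G ∧ ¬ G.Colorable 3 ∧
  ∀ H : G.Subgraph, H ≠ ⊤ → (H.coe.Colorable 3 ∨ HasInducedP5 H.coe)

/-- `G` is isomorphic to one of the six graphs `K4, W5, S1, S2, T, B`. -/
def IsoToSix {V : Type*} (G : SimpleGraph V) : Prop :=
  Nonempty (G ≃g graphK4) ∨ Nonempty (G ≃g graphW5) ∨ Nonempty (G ≃g graphS1) ∨
  Nonempty (G ≃g graphS2) ∨ Nonempty (G ≃g graphT) ∨ Nonempty (G ≃g graphB)

/-- `v` traces a 5-hole (an induced 5-cycle) in `G`. -/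
def IsFiveHole {V : Type*} (G : SimpleGraph V) (v : Fin 5 → V) : Prop :=
  Function.Injective v ∧ ∀ i j : Fin 5, G.Adj (v i) (v j) ↔ (j = i + 1 ∨ i = j + 1)

/-- `{a, b, c}` is a dominating clique of size 3 in `G`. -/
def IsDomClique3 {V : Type*} (G : SimpleGraph V) (a b c : V) : Prop :=
  a ≠ b ∧ a ≠ c ∧ b ≠ c ∧ G.Adj a b ∧ G.Adj a c ∧ G.Adj b c ∧
  ∀ x : V, x ≠ a → x ≠ b → x ≠ c → (G.Adj x a ∨ G.Adj x b ∨ G.Adj x c)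

/-- `H` is a subgraph of `G` (deleting vertices and edges): there is an injection of
vertices carrying edges to edges. -/
def ContainsSub {V W : Type*} (G : SimpleGraph V) (H : SimpleGraph W) : Prop :=
  ∃ f : W ↪ V, ∀ a b : W, H.Adj a b → G.Adj (f a) (f b)

/-- `G` is minimally non-`k`-colorable: not `k`-colorable, but every proper subgraph is. -/
def MinNonColorable {V : Type*} (k : ℕ) (G : SimpleGraph V) : Prop :=
  ¬ G.Colorable k ∧ ∀ H : G.Subgraph, H ≠ ⊤ → H.coe.Colorable k


/-- The forbidden configurations available in an MN3P5 graph without 5-holes, other than `K4`,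
together with vertex-criticality. The field `spindle` excludes the Moser spindle `S1`. -/
structure FiveHoleFreeCritical {V : Type*} (G : SimpleGraph V) : Prop where
  p5 : ∀ a b c d e, G.Adj a b → G.Adj b c → G.Adj c d → G.Adj d e → ¬ G.Adj a c → ¬ G.Adj a d →
    ¬ G.Adj a e → ¬ G.Adj b d → ¬ G.Adj b e → ¬ G.Adj c e → False
  c5 : ∀ a b c d e, G.Adj a b → G.Adj b c → G.Adj c d → G.Adj d e → G.Adj e a → ¬ G.Adj a c →
    ¬ G.Adj a d → ¬ G.Adj b d → ¬ G.Adj b e → ¬ G.Adj c e → False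
  k4 : ∀ a b c d, G.Adj a b → G.Adj a c → G.Adj a d → G.Adj b c → G.Adj b d → G.Adj c d → False
  spindle : ∀ a b c d e f g, G.Adj a b → G.Adj a c → G.Adj b c → G.Adj b d → G.Adj c d →
    G.Adj a e → G.Adj a f → G.Adj e f → G.Adj e g → G.Adj f g → G.Adj d g →
    a ≠ d → a ≠ g → b ≠ e → b ≠ f → b ≠ g → c ≠ e → c ≠ f → c ≠ g → d ≠ e → d ≠ f → False
  critical : ∀ S : Set V, S ≠ Set.univ →
    ∃ c : V → Fin 3, ∀ x ∈ S, ∀ y ∈ S, G.Adj x y → c x ≠ c y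
  not_colorable : ∀ c : V → Fin 3, ∃ x y, G.Adj x y ∧ c x = c y

/-- The vertices induce the complement of the 6-cycle `q0 q1 q2 q3 q4 q5` (a triangular prism). -/
structure IsCoHexagon {V : Type*} (G : SimpleGraph V) (q0 q1 q2 q3 q4 q5 : V) : Prop where
  a02 : G.Adj q0 q2
  a04 : G.Adj q0 q4
  a24 : G.Adj q2 q4
  a13 : G.Adj q1 q3
  a15 : G.Adj q1 q5
  a35 : G.Adj q3 q5
  a03 : G.Adj q0 q3
  a14 : G.Adj q1 q4
  a25 : G.Adj q2 q5
  n01 : ¬ G.Adj q0 q1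
  n12 : ¬ G.Adj q1 q2
  n23 : ¬ G.Adj q2 q3
  n34 : ¬ G.Adj q3 q4
  n45 : ¬ G.Adj q4 q5
  n05 : ¬ G.Adj q0 q5

/-- Among the six vertices, `x` misses exactly the first three. -/
def MissThree {V : Type*} (G : SimpleGraph V) (q0 q1 q2 q3 q4 q5 x : V) : Prop :=
  ¬ G.Adj x q0 ∧ ¬ G.Adj x q1 ∧ ¬ G.Adj x q2 ∧ G.Adj x q3 ∧ G.Adj x q4 ∧ G.Adj x q5

/-- Among the six vertices, `x` misses exactly the first two. -/
def MissTwo {V : Type*} (G : SimpleGraph V) (q0 q1 q2 q3 q4 q5 x : V) : Prop :=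
  ¬ G.Adj x q0 ∧ ¬ G.Adj x q1 ∧ G.Adj x q2 ∧ G.Adj x q3 ∧ G.Adj x q4 ∧ G.Adj x q5

/-- `x` misses all six vertices. -/
def MissAll {V : Type*} (G : SimpleGraph V) (q0 q1 q2 q3 q4 q5 x : V) : Prop :=
  ¬ G.Adj x q0 ∧ ¬ G.Adj x q1 ∧ ¬ G.Adj x q2 ∧ ¬ G.Adj x q3 ∧ ¬ G.Adj x q4 ∧ ¬ G.Adj x q5

/-- `x` attaches to the co-hexagon in one of the ways that force the same colour as `q0` and `q1`
in the 3-colouring pairing `q0` with `q1`, `q2` with `q3` and `q4` with `q5`. -/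
def InClass {V : Type*} (G : SimpleGraph V) (q0 q1 q2 q3 q4 q5 x : V) : Prop :=
  MissThree G q5 q0 q1 q2 q3 q4 x ∨ MissThree G q0 q1 q2 q3 q4 q5 x ∨ MissTwo G q0 q1 q2 q3 q4 q5 x

section Prism

variable {V : Type*} {G : SimpleGraph V} {q0 q1 q2 q3 q4 q5 : V}

theorem IsCoHexagon.rotate (p : IsCoHexagon G q0 q1 q2 q3 q4 q5) :
    IsCoHexagon G q1 q2 q3 q4 q5 q0 := by
  obtain ⟨a02, a04, a24, a13, a15, a35, a03, a14, a25, n01, n12, n23, n34, n45, n05⟩ := p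
  constructor <;> first | assumption | (rw [G.adj_comm]; assumption)

theorem IsCoHexagon.reflect (p : IsCoHexagon G q0 q1 q2 q3 q4 q5) :
    IsCoHexagon G q1 q0 q5 q4 q3 q2 := by
  obtain ⟨a02, a04, a24, a13, a15, a35, a03, a14, a25, n01, n12, n23, n34, n45, n05⟩ := p
  constructor <;> first | assumption | (rw [G.adj_comm]; assumption)

theorem FiveHoleFreeCritical.attachment (h : FiveHoleFreeCritical G)
    (p : IsCoHexagon G q0 q1 q2 q3 q4 q5) (x : V) :
    MissAll G q0 q1 q2 q3 q4 q5 x ∨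
    InClass G q0 q1 q2 q3 q4 q5 x ∨ InClass G q2 q3 q4 q5 q0 q1 x ∨
    InClass G q4 q5 q0 q1 q2 q3 x ∨
    MissTwo G q1 q2 q3 q4 q5 q0 x ∨ MissTwo G q3 q4 q5 q0 q1 q2 x ∨
      MissTwo G q5 q0 q1 q2 q3 q4 x := by
  obtain ⟨a02, a04, a24, a13, a15, a35, a03, a14, a25, n01, n12, n23, n34, n45, n05⟩ := p
  have k1 := h.k4 q0 q2 q4 x
  have k2 := h.k4 q1 q3 q5 x
  have k3 := h.c5 q0 q2 x q1 q3
  have k4 := h.c5 q0 q3 q5 x q4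
  have k5 := h.c5 q0 q4 q1 q5 x
  have k6 := h.p5 q0 q4 q1 q5 x
  have k7 := h.p5 q2 q0 q3 q1 x
  have k8 := h.c5 q0 q2 q5 q1 x
  have k9 := h.p5 q0 q2 q5 q1 x
  have k10 := h.p5 q1 q5 q2 q0 x
  have k11 := h.c5 q2 q4 x q3 q5
  have k12 := h.p5 q1 q3 q0 q2 x
  have k13 := h.p5 q3 q5 q2 q4 x
  have k14 := h.c5 q1 q3 x q2 q4
  have k15 := h.p5 q2 q4 q1 q3 x
  have k16 := h.p5 q3 q1 q4 q2 x
  have sy : ∀ a b, G.Adj a b ↔ G.Adj b a := G.adj_comm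
  unfold MissAll InClass MissTwo MissThree
  clear h
  grind (splits := 40)

theorem FiveHoleFreeCritical.inClass_adj (h : FiveHoleFreeCritical G)
    (p : IsCoHexagon G q0 q1 q2 q3 q4 q5) {x y : V} (hx : InClass G q0 q1 q2 q3 q4 q5 x)
    (hy : InClass G q0 q1 q2 q3 q4 q5 y) (hxy : G.Adj x y) :
    (MissThree G q5 q0 q1 q2 q3 q4 x ∧ MissThree G q0 q1 q2 q3 q4 q5 y) ∨
    (MissThree G q5 q0 q1 q2 q3 q4 y ∧ MissThree G q0 q1 q2 q3 q4 q5 x) := by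
  have k1 := h.k4 x y q2 q4
  have k2 := h.k4 x y q3 q5
  have a24 := p.a24
  have a35 := p.a35
  unfold InClass MissTwo MissThree at *
  clear h p
  grind (splits := 40)

theorem FiveHoleFreeCritical.missAll_adj (h : FiveHoleFreeCritical G)
    (p : IsCoHexagon G q0 q1 q2 q3 q4 q5) {x y : V} (hx : MissAll G q0 q1 q2 q3 q4 q5 x)
    (hy : InClass G q0 q1 q2 q3 q4 q5 y) (hxy : G.Adj x y) : MissTwo G q0 q1 q2 q3 q4 q5 y := by
  obtain ⟨a02, a04, a24, a13, a15, a35, a03, a14, a25, n01, n12, n23, n34, n45, n05⟩ := p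
  have k1 := h.p5 x y q3 q0 q2
  have k2 := h.p5 x y q2 q5 q1
  have sy : ∀ a b, G.Adj a b ↔ G.Adj b a := G.adj_comm
  unfold InClass MissAll MissTwo MissThree at *
  clear h
  grind (splits := 40)

open Classical in
theorem FiveHoleFreeCritical.false_of_coloring (h : FiveHoleFreeCritical G)
    (p : IsCoHexagon G q0 q1 q2 q3 q4 q5)
    (r1 : ∀ x, ¬ MissTwo G q1 q2 q3 q4 q5 q0 x)
    (r3 : ∀ x, ¬ MissTwo G q3 q4 q5 q0 q1 q2 x)
    (r5 : ∀ x, ¬ MissTwo G q5 q0 q1 q2 q3 q4 x)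
    (e0 : ∀ x y, MissThree G q5 q0 q1 q2 q3 q4 x → MissThree G q0 q1 q2 q3 q4 q5 y → ¬ G.Adj x y)
    (e2 : ∀ x y, MissThree G q1 q2 q3 q4 q5 q0 x → MissThree G q2 q3 q4 q5 q0 q1 y → ¬ G.Adj x y)
    (e4 : ∀ x y, MissThree G q3 q4 q5 q0 q1 q2 x → MissThree G q4 q5 q0 q1 q2 q3 y → ¬ G.Adj x y)
    (c : V → Fin 3) (hc : ∀ x ≠ q0, ∀ y ≠ q0, G.Adj x y → c x ≠ c y)
    (k0 k1 k2 : Fin 3) (h01 : k0 ≠ k1) (h02 : k0 ≠ k2) (h12 : k1 ≠ k2)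
    (c0 : ∀ x, MissTwo G q0 q1 q2 q3 q4 q5 x → c x = k0)
    (c2 : ∀ x, MissTwo G q2 q3 q4 q5 q0 q1 x → c x = k1)
    (c4 : ∀ x, MissTwo G q4 q5 q0 q1 q2 q3 x → c x = k2) : False := by
  obtain ⟨col, hcol⟩ : ∃ col : V → Fin 3, ∀ x,
      (MissAll G q0 q1 q2 q3 q4 q5 x ∧ col x = c x) ∨
      (InClass G q0 q1 q2 q3 q4 q5 x ∧ col x = k0) ∨
      (InClass G q2 q3 q4 q5 q0 q1 x ∧ col x = k1) ∨
      (InClass G q4 q5 q0 q1 q2 q3 x ∧ col x = k2) := by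
    have key : ∀ x, ∃ k : Fin 3,
      (MissAll G q0 q1 q2 q3 q4 q5 x ∧ k = c x) ∨
      (InClass G q0 q1 q2 q3 q4 q5 x ∧ k = k0) ∨
      (InClass G q2 q3 q4 q5 q0 q1 x ∧ k = k1) ∨
      (InClass G q4 q5 q0 q1 q2 q3 x ∧ k = k2) := by
      intro x
      rcases h.attachment p x with t | t | t | t | t | t | t
      · exact ⟨_, Or.inl ⟨t, rfl⟩⟩
      · exact ⟨_, Or.inr (Or.inl ⟨t, rfl⟩)⟩
      · exact ⟨_, Or.inr (Or.inr (Or.inl ⟨t, rfl⟩))⟩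
      · exact ⟨_, Or.inr (Or.inr (Or.inr ⟨t, rfl⟩))⟩
      · exact (r1 x t).elim
      · exact (r3 x t).elim
      · exact (r5 x t).elim
    choose col hcol using key
    exact ⟨col, hcol⟩
  have p2 := p.rotate.rotate
  have p4 := p2.rotate.rotate
  have stable0 : ∀ x y, InClass G q0 q1 q2 q3 q4 q5 x → InClass G q0 q1 q2 q3 q4 q5 y →
      ¬ G.Adj x y := by
    intro x y hx hy hxy
    rcases h.inClass_adj p hx hy hxy with ⟨s, t⟩ | ⟨s, t⟩
    exacts [e0 _ _ s t hxy, e0 _ _ s t hxy.symm]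
  have stable2 : ∀ x y, InClass G q2 q3 q4 q5 q0 q1 x → InClass G q2 q3 q4 q5 q0 q1 y →
      ¬ G.Adj x y := by
    intro x y hx hy hxy
    rcases h.inClass_adj p2 hx hy hxy with ⟨s, t⟩ | ⟨s, t⟩
    exacts [e2 _ _ s t hxy, e2 _ _ s t hxy.symm]
  have stable4 : ∀ x y, InClass G q4 q5 q0 q1 q2 q3 x → InClass G q4 q5 q0 q1 q2 q3 y →
      ¬ G.Adj x y := by
    intro x y hx hy hxy
    rcases h.inClass_adj p4 hx hy hxy with ⟨s, t⟩ | ⟨s, t⟩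
    exacts [e4 _ _ s t hxy, e4 _ _ s t hxy.symm]
  have far0 : ∀ x, MissAll G q0 q1 q2 q3 q4 q5 x → x ≠ q0 := by
    rintro x hx rfl
    exact hx.2.2.1 p.a02
  have two0 : ∀ x, MissTwo G q0 q1 q2 q3 q4 q5 x → x ≠ q0 := by
    rintro x hx rfl
    exact p.n05 hx.2.2.2.2.2
  have two2 : ∀ x, MissTwo G q2 q3 q4 q5 q0 q1 x → x ≠ q0 := by
    rintro x hx rfl
    exact hx.1 p.a02
  have two4 : ∀ x, MissTwo G q4 q5 q0 q1 q2 q3 x → x ≠ q0 := by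
    rintro x hx rfl
    exact hx.1 p.a04
  have far : ∀ x y, MissAll G q0 q1 q2 q3 q4 q5 x → G.Adj x y →
      (InClass G q0 q1 q2 q3 q4 q5 y → c x ≠ k0) ∧ (InClass G q2 q3 q4 q5 q0 q1 y → c x ≠ k1) ∧
      (InClass G q4 q5 q0 q1 q2 q3 y → c x ≠ k2) := by
    intro x y hx hxy
    have hx2 : MissAll G q2 q3 q4 q5 q0 q1 x := by unfold MissAll at *; tauto
    have hx4 : MissAll G q4 q5 q0 q1 q2 q3 x := by unfold MissAll at *; tauto
    refine ⟨fun hy => ?_, fun hy => ?_, fun hy => ?_⟩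
    · have t := h.missAll_adj p hx hy hxy
      exact c0 y t ▸ hc x (far0 x hx) y (two0 y t) hxy
    · have t := h.missAll_adj p2 hx2 hy hxy
      exact c2 y t ▸ hc x (far0 x hx) y (two2 y t) hxy
    · have t := h.missAll_adj p4 hx4 hy hxy
      exact c4 y t ▸ hc x (far0 x hx) y (two4 y t) hxy
  obtain ⟨x, y, hxy, heq⟩ := h.not_colorable col
  rcases hcol x with ⟨hx, ex⟩ | ⟨hx, ex⟩ | ⟨hx, ex⟩ | ⟨hx, ex⟩ <;>
  rcases hcol y with ⟨hy, ey⟩ | ⟨hy, ey⟩ | ⟨hy, ey⟩ | ⟨hy, ey⟩ <;>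
  rw [ex, ey] at heq
  · exact hc x (far0 x hx) y (far0 y hy) hxy heq
  · exact (far x y hx hxy).1 hy heq
  · exact (far x y hx hxy).2.1 hy heq
  · exact (far x y hx hxy).2.2 hy heq
  · exact (far y x hy hxy.symm).1 hx heq.symm
  · exact stable0 x y hx hy hxy
  · exact h01 heq
  · exact h02 heq
  · exact (far y x hy hxy.symm).2.1 hx heq.symm
  · exact h01 heq.symm
  · exact stable2 x y hx hy hxy
  · exact h12 heq
  · exact (far y x hy hxy.symm).2.2 hx heq.symm
  · exact h02 heq.symm
  · exact h12 heq.symm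
  · exact stable4 x y hx hy hxy

theorem FiveHoleFreeCritical.not_missTwo_next (h : FiveHoleFreeCritical G)
    (p : IsCoHexagon G q0 q1 q2 q3 q4 q5) {r y : V} (hr : MissTwo G q0 q1 q2 q3 q4 q5 r) :
    ¬ MissTwo G q1 q2 q3 q4 q5 q0 y := by
  intro contra
  obtain ⟨a02, a04, a24, a13, a15, a35, a03, a14, a25, n01, n12, n23, n34, n45, n05⟩ := p
  have k1 := h.k4 q3 q5 r y
  have sy : ∀ a b, G.Adj a b ↔ G.Adj b a := G.adj_comm
  unfold MissTwo at *
  have ir : ∀ a, ¬ G.Adj a a := fun a => G.irrefl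
  have ks := h.spindle q0 q2 q4 r q3 y q5
  clear h
  have : q0 ≠ r := by grind
  have : q0 ≠ q5 := by grind
  have : q2 ≠ q3 := by grind
  have : q2 ≠ y := by grind
  have : q2 ≠ q5 := by grind
  have : q4 ≠ q3 := by grind
  have : q4 ≠ y := by grind
  have : q4 ≠ q5 := by grind
  have : r ≠ q3 := by grind
  have : r ≠ y := by grind
  grind (splits := 40)

theorem FiveHoleFreeCritical.not_missTwo_opposite (h : FiveHoleFreeCritical G)
    (p : IsCoHexagon G q0 q1 q2 q3 q4 q5) {r y : V} (hr : MissTwo G q0 q1 q2 q3 q4 q5 r) :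
    ¬ MissTwo G q3 q4 q5 q0 q1 q2 y := by
  obtain ⟨a02, a04, a24, a13, a15, a35, a03, a14, a25, n01, n12, n23, n34, n45, n05⟩ := p
  have k1 := h.k4 q2 q5 r y
  have k2 := h.c5 q0 q4 r q5 y
  have sy : ∀ a b, G.Adj a b ↔ G.Adj b a := G.adj_comm
  unfold MissTwo at *
  clear h
  grind (splits := 40)

theorem FiveHoleFreeCritical.not_adj_missThree (h : FiveHoleFreeCritical G)
    (p : IsCoHexagon G q0 q1 q2 q3 q4 q5) {r x y : V} (hr : MissTwo G q0 q1 q2 q3 q4 q5 r)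
    (hx : MissThree G q5 q0 q1 q2 q3 q4 x) (hy : MissThree G q0 q1 q2 q3 q4 q5 y) :
    ¬ G.Adj x y := by
  intro contra
  obtain ⟨a02, a04, a24, a13, a15, a35, a03, a14, a25, n01, n12, n23, n34, n45, n05⟩ := p
  have k1 := h.k4 q3 q5 r y
  have k2 := h.k4 q2 q4 r x
  have sy : ∀ a b, G.Adj a b ↔ G.Adj b a := G.adj_comm
  unfold MissTwo MissThree at *
  have ir : ∀ a, ¬ G.Adj a a := fun a => G.irrefl
  have ks := h.spindle q2 q4 x y q5 r q3
  clear h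
  have : q2 ≠ y := by grind
  have : q2 ≠ q3 := by grind
  have : q4 ≠ q5 := by grind
  have : q4 ≠ r := by grind
  have : q4 ≠ q3 := by grind
  have : x ≠ q5 := by grind
  have : x ≠ r := by grind
  have : x ≠ q3 := by grind
  have : y ≠ q5 := by grind
  have : y ≠ r := by grind
  grind (splits := 40)

theorem FiveHoleFreeCritical.not_adj_missThree_of_two_apart (h : FiveHoleFreeCritical G)
    (p : IsCoHexagon G q0 q1 q2 q3 q4 q5) {r x y : V} (hr : MissTwo G q0 q1 q2 q3 q4 q5 r)
    (hx : MissThree G q1 q2 q3 q4 q5 q0 x) (hy : MissThree G q2 q3 q4 q5 q0 q1 y) :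
    ¬ G.Adj x y := by
  intro contra
  obtain ⟨a02, a04, a24, a13, a15, a35, a03, a14, a25, n01, n12, n23, n34, n45, n05⟩ := p
  have k1 := h.c5 q0 q4 r q5 y
  have k3 := h.k4 q5 r x y
  have sy : ∀ a b, G.Adj a b ↔ G.Adj b a := G.adj_comm
  unfold MissTwo MissThree at *
  have ir : ∀ a, ¬ G.Adj a a := fun a => G.irrefl
  have ks := h.spindle q0 q2 q4 r x y q5
  clear h
  have : q0 ≠ r := by grind
  have : q0 ≠ q5 := by grind
  have : q2 ≠ x := by grind
  have : q2 ≠ y := by grind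
  have : q2 ≠ q5 := by grind
  have : q4 ≠ x := by grind
  have : q4 ≠ y := by grind
  have : q4 ≠ q5 := by grind
  have : r ≠ x := by grind
  have : r ≠ y := by grind
  grind (splits := 40)

theorem fin_three_eq {a b c d : Fin 3} (hab : a ≠ b) (hac : a ≠ c) (hbc : b ≠ c) (hdb : d ≠ b)
    (hdc : d ≠ c) : d = a := by
  omega

theorem FiveHoleFreeCritical.not_missTwo (h : FiveHoleFreeCritical G)
    (p : IsCoHexagon G q0 q1 q2 q3 q4 q5) (r : V) : ¬ MissTwo G q0 q1 q2 q3 q4 q5 r := by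
  intro hr
  have hr' : MissTwo G q1 q0 q5 q4 q3 q2 r := by unfold MissTwo at *; tauto
  obtain ⟨c, hc⟩ := h.critical {q0}ᶜ (by simp)
  replace hc : ∀ x ≠ q0, ∀ y ≠ q0, G.Adj x y → c x ≠ c y := hc
  have n1 : q1 ≠ q0 := by rintro rfl; exact p.n12 p.a02
  have n2 : q2 ≠ q0 := p.a02.ne'
  have n3 : q3 ≠ q0 := p.a03.ne'
  have n4 : q4 ≠ q0 := p.a04.ne'
  have n5 : q5 ≠ q0 := by rintro rfl; exact p.n45 p.a04.symm
  have nr : r ≠ q0 := by rintro rfl; exact p.n05 hr.2.2.2.2.2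
  have r2 := hc r nr q2 n2 hr.2.2.1
  have r3 := hc r nr q3 n3 hr.2.2.2.1
  have r4 := hc r nr q4 n4 hr.2.2.2.2.1
  have r5 := hc r nr q5 n5 hr.2.2.2.2.2
  have c24 := hc q2 n2 q4 n4 p.a24
  have c25 := hc q2 n2 q5 n5 p.a25
  have c35 := hc q3 n3 q5 n5 p.a35
  have c13 := hc q1 n1 q3 n3 p.a13
  have c15 := hc q1 n1 q5 n5 p.a15
  have f5 : c q5 = c q4 := fin_three_eq r4.symm c24.symm r2 r5.symm c25.symm
  rw [f5] at c35 c15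
  have f3 : c q3 = c q2 := fin_three_eq r2.symm c24 r4 r3.symm c35
  rw [f3] at c13
  have f1 : c q1 = c r := fin_three_eq r2 r4 c24 c13 c15
  refine h.false_of_coloring p (fun x => h.not_missTwo_next p hr)
    (fun x => h.not_missTwo_opposite p hr) (fun x hx => ?_)
    (fun x y => h.not_adj_missThree p hr)
    (fun x y => h.not_adj_missThree_of_two_apart p hr) (fun x y hx hy hxy => ?_)
    c hc (c r) (c q2) (c q4) r2 r4 c24 (fun x hx => ?_) (fun x hx => ?_) (fun x hx => ?_)
  · refine h.not_missTwo_next p.reflect hr' (y := x) ?_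
    unfold MissTwo at *
    tauto
  · refine h.not_adj_missThree_of_two_apart p.reflect hr' (x := y) (y := x) ?_ ?_ hxy.symm <;>
    · unfold MissThree at *
      tauto
  · have nx : x ≠ q0 := by rintro rfl; exact p.n05 hx.2.2.2.2.2
    exact fin_three_eq r2 r4 c24 (hc x nx q2 n2 hx.2.2.1) (hc x nx q4 n4 hx.2.2.2.2.1)
  · have nx : x ≠ q0 := by rintro rfl; exact hx.1 p.a02
    exact fin_three_eq r2.symm c24 r4 (f1 ▸ hc x nx q1 n1 hx.2.2.2.2.2) (hc x nx q4 n4 hx.2.2.1)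
  · have nx : x ≠ q0 := by rintro rfl; exact hx.1 p.a04
    exact fin_three_eq r4.symm c24.symm r2 (f1 ▸ hc x nx q1 n1 hx.2.2.2.1)
      (hc x nx q2 n2 hx.2.2.2.2.1)

theorem FiveHoleFreeCritical.not_adj_missThree' (h : FiveHoleFreeCritical G)
    (p : IsCoHexagon G q0 q1 q2 q3 q4 q5) (x y : V) (hx : MissThree G q5 q0 q1 q2 q3 q4 x)
    (hy : MissThree G q0 q1 q2 q3 q4 q5 y) : ¬ G.Adj x y := by
  intro hxy
  have p' : IsCoHexagon G x q1 q2 q3 q4 q5 :=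
    { p with a02 := hx.2.2.2.1, a03 := hx.2.2.2.2.1, a04 := hx.2.2.2.2.2, n01 := hx.2.2.1,
             n05 := hx.1 }
  exact h.not_missTwo p'.rotate y ⟨hy.2.1, hy.2.2.1, hy.2.2.2.1, hy.2.2.2.2.1, hy.2.2.2.2.2, hxy.symm⟩

theorem FiveHoleFreeCritical.not_isCoHexagon (h : FiveHoleFreeCritical G) (q0 q1 q2 q3 q4 q5 : V) :
    ¬ IsCoHexagon G q0 q1 q2 q3 q4 q5 := by
  intro p
  obtain ⟨c, hc⟩ := h.critical {q0}ᶜ (by simp)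
  have p2 := p.rotate.rotate
  have p4 := p2.rotate.rotate
  exact h.false_of_coloring p (h.not_missTwo p.rotate) (h.not_missTwo p2.rotate)
    (h.not_missTwo p4.rotate) (h.not_adj_missThree' p) (h.not_adj_missThree' p2)
    (h.not_adj_missThree' p4) c hc 0 1 2 (by decide) (by decide) (by decide)
    (fun x hx => (h.not_missTwo p x hx).elim) (fun x hx => (h.not_missTwo p2 x hx).elim)
    (fun x hx => (h.not_missTwo p4 x hx).elim)

end Prism

/-- `K` induces a connected subgraph: a nonempty part of `K` closed under adjacency in `K` is all
of `K`. -/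
def IsConnectedSet {V : Type*} (G : SimpleGraph V) (K : Set V) : Prop :=
  ∀ D ⊆ K, D.Nonempty → (∀ d ∈ D, ∀ e ∈ K, G.Adj d e → e ∈ D) → K ⊆ D

theorem isConnectedSet_singleton {V : Type*} (G : SimpleGraph V) (a : V) :
    IsConnectedSet G {a} := by
  rintro D hD ⟨d, hd⟩ -
  have : d = a := hD hd
  rintro b rfl
  exact this ▸ hd

theorem IsConnectedSet.insert {V : Type*} {G : SimpleGraph V} {K : Set V}
    (hK : IsConnectedSet G K) {t k : V} (hk : k ∈ K) (htk : G.Adj t k) :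
    IsConnectedSet G (insert t K) := by
  intro D hD hne hcl
  have hkD : k ∈ D := by
    by_cases htD : t ∈ D
    · exact hcl t htD k (Or.inr hk) htk
    · obtain ⟨d, hd⟩ := hne
      have sub : D ⊆ K := fun z hz => (hD hz).resolve_left (by rintro rfl; exact htD hz)
      exact hK D sub ⟨d, hd⟩ (fun a ha e he hae => hcl a ha e (Or.inr he) hae) hk
  have hKD : K ⊆ D ∩ K := hK (D ∩ K) Set.inter_subset_right ⟨k, hkD, hk⟩
    fun a ha e he hae => ⟨hcl a ha.1 e (Or.inr he) hae, he⟩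
  rintro z (rfl | hz)
  · exact hcl k hkD z (Or.inl rfl) htk.symm
  · exact (hKD hz).1

/-- If `T ⊆ N(v)` is not complete multipartite and is attached to a connected set `K` of
non-neighbours of `v`, then some vertex of `K` is complete to `T`. -/
theorem FiveHoleFreeCritical.exists_complete_vertex {V : Type*} [Finite V] {G : SimpleGraph V}
    (h : FiveHoleFreeCritical G) {v : V} {K T : Set V} (hK : IsConnectedSet G K)
    (hv : ∀ k ∈ K, ¬ G.Adj v k) (hT : ∀ t ∈ T, G.Adj v t) (hTK : ∀ t ∈ T, ∃ k ∈ K, G.Adj t k)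
    {x y w : V} (hx : x ∈ T) (hy : y ∈ T) (hw : w ∈ T) (hxy : G.Adj x y) (hwx : ¬ G.Adj w x)
    (hwy : ¬ G.Adj w y) : ∃ m ∈ K, ∀ t ∈ T, G.Adj t m := by
  have star : ∀ t ∈ T, ∀ s ∈ T, ¬ G.Adj t s → ∀ m ∈ K, ∀ m' ∈ K, G.Adj m m' → G.Adj t m →
      ¬ G.Adj t m' → G.Adj s m := by
    intro t ht s hs hts m hm m' hm' hmm htm htm'
    by_contra hsm
    by_cases hsm' : G.Adj s m'
    · exact h.c5 v t m m' s (hT t ht) htm hmm hsm'.symm (hT s hs).symm (hv m hm) (hv m' hm') htm'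
        hts (fun e => hsm e.symm)
    · exact h.p5 s v t m m' (hT s hs).symm (hT t ht) htm hmm (fun e => hts e.symm) hsm hsm'
        (hv m hm) (hv m' hm') htm'
  have join : ∀ A ⊆ T, ∀ a ∈ A, ∀ b ∈ T, b ∉ A → ∃ a ∈ A, ∃ b ∈ T, b ∉ A ∧ ¬ G.Adj a b := by
    intro A hA a ha b hb hbA
    by_contra! hcon
    by_cases hwA : w ∈ A
    · have hxA : x ∈ A := by
        by_contra hxA
        exact hwx (hcon w hwA x hx hxA)
      have hyA : y ∈ A := by
        by_contra hyA
        exact hwy (hcon w hwA y hy hyA)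
      exact h.k4 v b x y (hT b hb) (hT x hx) (hT y hy) (hcon x hxA b hb hbA).symm
        (hcon y hyA b hb hbA).symm hxy
    · have hxA : x ∉ A := fun hxA => hwx (hcon x hxA w hw hwA).symm
      have hyA : y ∉ A := fun hyA => hwy (hcon y hyA w hw hwA).symm
      exact h.k4 v a x y (hT a (hA ha)) (hT x hx) (hT y hy) (hcon a ha x hx hxA)
        (hcon a ha y hy hyA) hxy
  obtain ⟨k0, hk0, hxk0⟩ := hTK x hx
  obtain ⟨m, hm, hmax⟩ := Set.exists_max_image K (fun k => {t ∈ T | G.Adj t k}.ncard)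
    (Set.toFinite K) ⟨k0, hk0⟩
  refine ⟨m, hm, ?_⟩
  by_contra! hcon
  obtain ⟨t0, ht0, ht0m⟩ := hcon
  have hpos : ({t ∈ T | G.Adj t m}).Nonempty := by
    have hne : ({t ∈ T | G.Adj t k0}).Nonempty := ⟨x, hx, hxk0⟩
    rw [← Set.ncard_pos (Set.toFinite _)] at hne ⊢
    exact lt_of_lt_of_le hne (hmax k0 hk0)
  obtain ⟨s0, hs0⟩ := hpos
  clear! x y w k0
  obtain ⟨w, ⟨hw, hwm⟩, x, hx, hxm, hwx⟩ := join {t ∈ T | G.Adj t m} (fun t ht => ht.1) s0 hs0 t0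
    ht0 (fun e => ht0m e.2)
  replace hxm : ¬ G.Adj x m := fun e => hxm ⟨hx, e⟩
  obtain ⟨p, hp, hxp, hmp⟩ : ∃ p ∈ K, G.Adj x p ∧ G.Adj m p := by
    have key := hK {k ∈ K | G.Adj x k ∨ ∃ p ∈ K, G.Adj x p ∧ G.Adj k p} (fun k hk => hk.1)
      (by obtain ⟨k, hk, hxk⟩ := hTK x hx; exact ⟨k, hk, Or.inl hxk⟩) (by
        rintro d ⟨hd, hd'⟩ e he hde
        refine ⟨he, ?_⟩
        by_cases hxd : G.Adj x d
        · exact Or.inr ⟨d, hd, hxd, hde.symm⟩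
        obtain ⟨p, hp, hxp, hdp⟩ := hd'.resolve_left hxd
        by_contra! hcon
        exact h.p5 v x p d e (hT x hx) hxp hdp.symm hde (hv p hp) (hv d hd) (hv e he) hxd hcon.1
          (fun e' => hcon.2 p hp hxp e'.symm))
    exact (key hm).2.resolve_left hxm
  obtain ⟨y, hy, hym, hyp⟩ : ∃ y ∈ T, G.Adj y m ∧ ¬ G.Adj y p := by
    by_contra! hcon
    have : {t ∈ T | G.Adj t m}.ncard < {t ∈ T | G.Adj t p}.ncard :=
      Set.ncard_lt_ncard ⟨fun t ht => ⟨ht.1, hcon t ht.1 ht.2⟩, fun hsub => hxm (hsub ⟨hx, hxp⟩).2⟩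
        (Set.toFinite _)
    exact absurd (hmax p hp) (not_le.2 this)
  have starx : ∀ s ∈ T, ¬ G.Adj x s → G.Adj s p := fun s hs hxs =>
    star x hx s hs hxs p hp m hm hmp.symm hxp hxm
  have stary : ∀ s ∈ T, ¬ G.Adj y s → G.Adj s m := fun s hs hys =>
    star y hy s hs hys m hm p hp hmp hym hyp
  have hxy : G.Adj x y := by
    by_contra hxy
    exact hyp (starx y hy hxy)
  have prism : ∀ z ∈ T, ¬ G.Adj x z → ¬ G.Adj y z → False := fun z hz hxz hyz =>
    h.not_isCoHexagon v m x z y p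
      { a02 := hT x hx, a04 := hT y hy, a24 := hxy, a13 := (stary z hz hyz).symm, a15 := hmp
        a35 := starx z hz hxz, a03 := hT z hz, a14 := hym.symm, a25 := hxp
        n01 := hv m hm, n12 := fun e => hxm e.symm, n23 := hxz, n34 := fun e => hyz e.symm
        n45 := hyp, n05 := hv p hp }
  have tri : ∀ z ∈ T, G.Adj x z → G.Adj y z → False := fun z hz hxz hyz =>
    h.k4 v x y z (hT x hx) (hT y hy) (hT z hz) hxy hxz hyz
  obtain ⟨a, ⟨ha, hya⟩, b, hb, hyb, hab⟩ := join {t ∈ T | G.Adj y t} (fun t ht => ht.1) x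
    ⟨hx, hxy.symm⟩ y hy (fun e => G.irrefl e.2)
  replace hyb : ¬ G.Adj y b := fun e => hyb ⟨hb, e⟩
  have hxa : ¬ G.Adj x a := fun e => tri a ha e hya
  have hxb : G.Adj x b := by
    by_contra hxb
    exact prism b hb hxb hyb
  have hap := starx a ha hxa
  have hbm := stary b hb hyb
  have ham : G.Adj a m := by
    by_contra ham
    have hbp := star a ha b hb hab p hp m hm hmp.symm hap ham
    exact h.not_isCoHexagon v m a b y p
      { a02 := hT a ha, a04 := hT y hy, a24 := hya.symm, a13 := hbm.symm, a15 := hmp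
        a35 := hbp, a03 := hT b hb, a14 := hym.symm, a25 := hap
        n01 := hv m hm, n12 := fun e => ham e.symm, n23 := hab, n34 := fun e => hyb e.symm
        n45 := hyp, n05 := hv p hp }
  have hbp : G.Adj b p := by
    by_contra hbp
    exact h.not_isCoHexagon v m x a b p
      { a02 := hT x hx, a04 := hT b hb, a24 := hxb, a13 := ham.symm, a15 := hmp
        a35 := hap, a03 := hT a ha, a14 := hbm.symm, a25 := hxp
        n01 := hv m hm, n12 := fun e => hxm e.symm, n23 := hxa, n34 := hab
        n45 := hbp, n05 := hv p hp }
  have ne : ∀ {t s z}, G.Adj t z → ¬ G.Adj s z → t ≠ s := by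
    rintro t s z h1 h2 rfl
    exact h2 h1
  exact h.spindle x b p m y v a hxb hxp hbp hbm hmp.symm hxy (hT x hx).symm (hT y hy).symm hya
    (hT a ha) ham.symm (ne (hT x hx).symm fun e => hv m hm e.symm) (ne hxb hab) (ne hbp hyp)
    (ne hbm (hv m hm)) (ne hxb.symm fun e => hxa e.symm) (ne hbp.symm hyb) (ne hmp.symm (hv m hm))
    (ne hbp.symm hab) (ne hmp hyp) (ne hmp (hv p hp))

/-- If `T ⊆ N(v)` is complete multipartite and `K` consists of non-neighbours of `v`, then a Kempe
change argument yields a colouring that is constant on the parts of `T`. -/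
theorem FiveHoleFreeCritical.exists_uniform_coloring {V : Type*} [Finite V] {G : SimpleGraph V}
    (h : FiveHoleFreeCritical G) {v : V} {K T : Set V}
    (hv : ∀ k ∈ K, ¬ G.Adj v k) (hT : ∀ t ∈ T, G.Adj v t)
    (multi : ∀ x ∈ T, ∀ y ∈ T, ∀ w ∈ T, G.Adj x y → G.Adj w x ∨ G.Adj w y)
    (hc : ∃ c : V → Fin 3, ∀ x ∈ K ∪ T, ∀ y ∈ K ∪ T, G.Adj x y → c x ≠ c y) :
    ∃ c : V → Fin 3, (∀ x ∈ K ∪ T, ∀ y ∈ K ∪ T, G.Adj x y → c x ≠ c y) ∧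
      ∀ x ∈ T, ∀ y ∈ T, ¬ G.Adj x y → c x = c y := by
  obtain ⟨c, hc, hmin⟩ := Set.exists_min_image
    {c : V → Fin 3 | ∀ x ∈ K ∪ T, ∀ y ∈ K ∪ T, G.Adj x y → c x ≠ c y}
    (fun c => (Set.image c T).ncard) (Set.toFinite _) hc
  refine ⟨c, hc, ?_⟩
  by_contra! hcon
  obtain ⟨t, ht, t', ht', htt, hne⟩ := hcon
  have inT : ∀ x ∈ T, x ∈ K ∪ T := fun x hx => Or.inr hx
  have noedge : ∀ s ∈ T, ∀ s' ∈ T, c s = c t → c s' = c t' → ¬ G.Adj s s' := by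
    intro s hs s' hs' e e' hss
    have h1 : G.Adj t s' := (multi s hs s' hs' t ht hss).resolve_left
      fun a => hc t (inT t ht) s (inT s hs) a e.symm
    rcases multi t ht s' hs' t' ht' h1 with a | a
    · exact htt a.symm
    · exact hc t' (inT t' ht') s' (inT s' hs') a e'.symm
  let F : Set V := {x | x ∈ K ∪ T ∧ ((c x = c t' ∧ (x ∈ T ∨ ∃ p ∈ K ∪ T, c p = c t ∧ G.Adj p x ∧
    ∃ s ∈ T, c s = c t' ∧ G.Adj s p)) ∨ (c x = c t ∧ ∃ s ∈ T, c s = c t' ∧ G.Adj s x))}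
  have hF : ∀ x ∈ F, c x = c t ∨ c x = c t' := fun x hx => hx.2.elim (fun e => Or.inr e.1)
    (fun e => Or.inl e.1)
  classical
  let c' : V → Fin 3 := fun x => if x ∈ F then Equiv.swap (c t) (c t') (c x) else c x
  have hcross : ∀ x ∈ F, ∀ y ∈ K ∪ T, y ∉ F → G.Adj x y → c' x ≠ c' y := by
    intro x hx y hy hyF hxy
    simp only [c', if_pos hx, if_neg hyF]
    obtain ⟨hx', ⟨e, hx_alt⟩ | ⟨e, s, hs, es, hsx⟩⟩ := hx
    · rw [e, Equiv.swap_apply_right]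
      intro ey
      by_cases hxT : x ∈ T
      · exact hyF ⟨hy, Or.inr ⟨ey.symm, x, hxT, e, hxy⟩⟩
      obtain ⟨p, hp, ep, hpx, s, hs, es, hsp⟩ := hx_alt.resolve_left hxT
      have hpK : p ∈ K := hp.resolve_right fun hpT => noedge p hpT s hs ep es hsp.symm
      have hxK : x ∈ K := hx'.resolve_right hxT
      have hsx : ¬ G.Adj s x := fun a => hc s (inT s hs) x hx' a (es.trans e.symm)
      have hsy : ¬ G.Adj s y := fun a => hyF ⟨hy, Or.inr ⟨ey.symm, s, hs, es, a⟩⟩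
      have hpy : ¬ G.Adj p y := fun a => hc p hp y hy a (ep.trans ey)
      by_cases hyT : y ∈ T
      · exact h.c5 v s p x y (hT s hs) hsp hpx hxy (hT y hyT).symm (hv p hpK) (hv x hxK) hsx hsy hpy
      · exact h.p5 v s p x y (hT s hs) hsp hpx hxy (hv p hpK) (hv x hxK)
          (hv y (hy.resolve_right hyT)) hsx hsy hpy
    · rw [e, Equiv.swap_apply_left]
      intro ey
      exact hyF ⟨hy, Or.inl ⟨ey.symm, Or.inr ⟨x, hx', e, hxy, s, hs, es, hsx⟩⟩⟩
  have hproper : ∀ x ∈ K ∪ T, ∀ y ∈ K ∪ T, G.Adj x y → c' x ≠ c' y := by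
    intro x hx y hy hxy
    by_cases hxF : x ∈ F <;> by_cases hyF : y ∈ F
    · simpa only [c', if_pos hxF, if_pos hyF, ne_eq, EmbeddingLike.apply_eq_iff_eq]
        using hc x hx y hy hxy
    · exact hcross x hxF y hy hyF hxy
    · exact (hcross y hyF x hx hxF hxy.symm).symm
    · simpa only [c', if_neg hxF, if_neg hyF] using hc x hx y hy hxy
  have himg : ∀ x ∈ T, c' x ∈ Set.image c T ∧ c' x ≠ c t' := by
    intro x hx
    by_cases hxF : x ∈ F
    · have e : c x = c t' := by
        rcases hxF.2 with ⟨e, -⟩ | ⟨e, s, hs, es, hsx⟩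
        · exact e
        · exact (noedge x hx s hs e es hsx.symm).elim
      simp only [c', if_pos hxF, e, Equiv.swap_apply_right]
      exact ⟨⟨t, ht, rfl⟩, hne⟩
    · simp only [c', if_neg hxF]
      exact ⟨⟨x, hx, rfl⟩, fun e => hxF ⟨inT x hx, Or.inl ⟨e, Or.inl hx⟩⟩⟩
  refine absurd (hmin c' hproper) (not_le.2 (Set.ncard_lt_ncard ⟨?_, ?_⟩ (Set.toFinite _)))
  · rintro _ ⟨x, hx, rfl⟩
    exact (himg x hx).1
  · intro hsub
    obtain ⟨x, hx, e⟩ := hsub ⟨t', ht', rfl⟩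
    exact (himg x hx).2 e

theorem FiveHoleFreeCritical.exists_nonadj {V : Type*} [Finite V] {G : SimpleGraph V}
    (h : FiveHoleFreeCritical G) : ∃ v k, v ≠ k ∧ ¬ G.Adj v k := by
  by_contra! hcon
  have := Fintype.ofFinite V
  rcases le_or_gt (Fintype.card V) 3 with hle | hlt
  · obtain ⟨f⟩ : Nonempty (V ↪ Fin 3) := Function.Embedding.nonempty_of_card_le (by simpa using hle)
    obtain ⟨x, y, hxy, e⟩ := h.not_colorable f
    exact hxy.ne (f.injective e)
  · obtain ⟨f⟩ : Nonempty (Fin 4 ↪ V) :=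
      Function.Embedding.nonempty_of_card_le (by rw [Fintype.card_fin]; omega)
    have key : ∀ i j, i ≠ j → G.Adj (f i) (f j) := fun i j hij => hcon _ _ (f.injective.ne hij)
    exact h.k4 _ _ _ _ (key 0 1 (by decide)) (key 0 2 (by decide)) (key 0 3 (by decide))
      (key 1 2 (by decide)) (key 1 3 (by decide)) (key 2 3 (by decide))

theorem FiveHoleFreeCritical.false {V : Type*} [Finite V] {G : SimpleGraph V}
    (h : FiveHoleFreeCritical G) : False := by
  obtain ⟨v0, k0, hne, hvk⟩ := h.exists_nonadj
  let Good : V → Set V → Prop := fun v K =>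
    K.Nonempty ∧ IsConnectedSet G K ∧ v ∉ K ∧ ∀ k ∈ K, ¬ G.Adj v k
  obtain ⟨⟨v, K⟩, hgood, hmax⟩ := Set.exists_max_image {P : V × Set V | Good P.1 P.2}
    (fun P => P.2.ncard) (Set.toFinite _) ⟨(v0, {k0}), ⟨k0, rfl⟩, isConnectedSet_singleton G k0, hne,
      by rintro k rfl; exact hvk⟩
  replace hgood : Good v K := hgood
  obtain ⟨hKne, hKconn, hvK, hv⟩ := hgood
  let T : Set V := {t | t ∉ K ∧ ∃ k ∈ K, G.Adj t k}
  have hU : ∀ u, u ∉ K ∪ T → ∀ k ∈ K, ¬ G.Adj u k := fun u hu k hk huk =>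
    hu (Or.inr ⟨fun e => hu (Or.inl e), k, hk, huk⟩)
  have hUT : ∀ u, u ∉ K ∪ T → ∀ t ∈ T, G.Adj u t := by
    rintro u hu t ⟨htK, k, hk, htk⟩
    by_contra hut
    have good : Good u (insert t K) := ⟨Set.insert_nonempty _ _, hKconn.insert hk htk,
      by
        rintro (rfl | e)
        · exact hu (Or.inr ⟨htK, k, hk, htk⟩)
        · exact hu (Or.inl e),
      by
        rintro z (rfl | hz)
        · exact hut
        · exact hU u hu z hz⟩
    have := hmax (u, insert t K) good
    simp only [Set.ncard_insert_of_notMem htK (Set.toFinite _)] at this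
    omega
  have hvU : v ∉ K ∪ T := by
    rintro (e | ⟨-, k, hk, e⟩)
    · exact hvK e
    · exact hv k hk e
  have hT : ∀ t ∈ T, G.Adj v t := hUT v hvU
  have hUstable : ∀ x ∈ T, ∀ y ∈ T, G.Adj x y → ∀ u, u ∉ K ∪ T → ∀ u', u' ∉ K ∪ T → ¬ G.Adj u u' :=
    fun x hx y hy hxy u hu u' hu' e => h.k4 u u' x y e (hUT u hu x hx) (hUT u hu y hy)
      (hUT u' hu' x hx) (hUT u' hu' y hy) hxy
  classical
  by_cases multi : ∀ x ∈ T, ∀ y ∈ T, ∀ w ∈ T, G.Adj x y → G.Adj w x ∨ G.Adj w y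
  · obtain ⟨c, hc, hcT⟩ := h.exists_uniform_coloring hv hT multi
      (h.critical _ fun e => hvU (e ▸ Set.mem_univ v))
    suffices ∃ d : V → Fin 3, (∀ x, x ∉ K ∪ T → ∀ y, y ∉ K ∪ T → G.Adj x y → d x ≠ d y) ∧
        ∀ x, x ∉ K ∪ T → ∀ t ∈ T, d x ≠ c t by
      obtain ⟨d, hd, hdT⟩ := this
      obtain ⟨x, y, hxy, e⟩ := h.not_colorable fun z => if z ∈ K ∪ T then c z else d z
      have cross : ∀ x, x ∉ K ∪ T → ∀ y ∈ K ∪ T, G.Adj x y → d x ≠ c y := by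
        rintro x hx y (hy | hy) hxy
        · exact (hU x hx y hy hxy).elim
        · exact hdT x hx y hy
      by_cases hx : x ∈ K ∪ T <;> by_cases hy : y ∈ K ∪ T <;>
        simp only [hx, hy, if_true, if_false] at e
      · exact hc x hx y hy hxy e
      · exact cross y hy x hx hxy.symm e.symm
      · exact cross x hx y hy hxy e
      · exact hd x hx y hy hxy e
    by_cases hedge : ∃ x ∈ T, ∃ y ∈ T, G.Adj x y
    · obtain ⟨x, hx, y, hy, hxy⟩ := hedge
      obtain ⟨i, hix, hiy⟩ : ∃ i : Fin 3, i ≠ c x ∧ i ≠ c y := by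
        generalize c x = a
        generalize c y = b
        revert a b
        decide
      refine ⟨fun _ => i, fun u hu u' hu' e => (hUstable x hx y hy hxy u hu u' hu' e).elim,
        fun u hu t ht => ?_⟩
      by_cases hxt : G.Adj x t
      · by_cases hyt : G.Adj y t
        · exact (h.k4 v x y t (hT x hx) (hT y hy) (hT t ht) hxy hxt hyt).elim
        · exact hcT y hy t ht hyt ▸ hiy
      · exact hcT x hx t ht hxt ▸ hix
    · push Not at hedge
      obtain ⟨k, hk⟩ := hKne
      obtain ⟨d, hd⟩ := h.critical Kᶜ fun e => by
        have : k ∈ Kᶜ := e ▸ Set.mem_univ k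
        exact this hk
      have hUK : ∀ u, u ∉ K ∪ T → u ∈ Kᶜ := fun u hu e => hu (Or.inl e)
      by_cases hTne : T.Nonempty
      · obtain ⟨t, ht⟩ := hTne
        refine ⟨fun u => Equiv.swap (d t) (c t) (d u), fun x hx y hy hxy => ?_,
          fun u hu t' ht' => ?_⟩
        · simpa using hd x (hUK x hx) y (hUK y hy) hxy
        · rw [hcT t' ht' t ht (hedge t' ht' t ht)]
          intro e
          have e' : d u = d t := by
            rw [← Equiv.swap_apply_left (d t) (c t)] at e
            exact (Equiv.swap (d t) (c t)).injective (by simpa using e)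
          exact hd u (hUK u hu) t ht.1 (hUT u hu t ht) e'
      · exact ⟨d, fun x hx y hy => hd x (hUK x hx) y (hUK y hy), fun u hu t ht =>
          (hTne ⟨t, ht⟩).elim⟩
  · push Not at multi
    obtain ⟨x, hx, y, hy, w, hw, hxy, hwx, hwy⟩ := multi
    obtain ⟨m, hm, hmT⟩ := h.exists_complete_vertex hKconn hv hT (fun t ht => ht.2) hx hy hw hxy
      hwx hwy
    have hmv : m ≠ v := fun e => hvK (e ▸ hm)
    obtain ⟨c, hc⟩ := h.critical {v}ᶜ fun e => by
      have : v ∈ ({v}ᶜ : Set V) := e ▸ Set.mem_univ v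
      exact this rfl
    have nbr : ∀ z, G.Adj v z → c z ≠ c m := by
      intro z hvz
      have hzT : z ∈ T := by
        by_contra hzT
        by_cases hzK : z ∈ K
        · exact hv z hzK hvz
        · exact hUstable x hx y hy hxy v hvU z (fun e => e.elim hzK hzT) hvz
      exact hc z hvz.ne' m hmv (hmT z hzT)
    obtain ⟨a, b, hab, e⟩ := h.not_colorable (Function.update c v (c m))
    by_cases ha : a = v
    · subst ha
      rw [Function.update_self, Function.update_of_ne hab.ne'] at e
      exact nbr b hab e.symm
    by_cases hb : b = v
    · subst hb
      rw [Function.update_self, Function.update_of_ne hab.ne] at e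
      exact nbr a hab.symm e
    rw [Function.update_of_ne ha, Function.update_of_ne hb] at e
    exact hc a ha b hb hab e

theorem HasInducedP5.of_path {V : Type*} {G : SimpleGraph V} {a b c d e : V} (hab : G.Adj a b)
    (hbc : G.Adj b c) (hcd : G.Adj c d) (hde : G.Adj d e) (hac : ¬ G.Adj a c) (had : ¬ G.Adj a d)
    (hae : ¬ G.Adj a e) (hbd : ¬ G.Adj b d) (hbe : ¬ G.Adj b e) (hce : ¬ G.Adj c e) :
    HasInducedP5 G := by
  have key : ∀ i j : Fin 5, (pathGraph 5).Adj i j ↔ G.Adj (![a, b, c, d, e] i) (![a, b, c, d, e] j)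
    := by
    intro i j
    fin_cases i <;> fin_cases j <;> simp [pathGraph_adj, *, G.adj_comm]
  have twinfree : ∀ i j : Fin 5, (∀ k : Fin 5, (i.val + 1 = k.val ∨ k.val + 1 = i.val) ↔
      (j.val + 1 = k.val ∨ k.val + 1 = j.val)) → i = j := by decide
  refine ⟨⟨![a, b, c, d, e], fun i j hij => twinfree i j fun k => ?_⟩, key⟩
  rw [← pathGraph_adj, ← pathGraph_adj, key, key, hij]

theorem HasInducedP5.map {V W : Type*} {G : SimpleGraph V} {H : SimpleGraph W} (f : H ↪g G)
    (h : HasInducedP5 H) : HasInducedP5 G := by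
  obtain ⟨g, hg⟩ := h
  exact ⟨g.trans f.toEmbedding, fun a b => (hg a b).trans f.map_adj_iff.symm⟩

theorem IsMN3P5.exists_coloring_on {V : Type*} {G : SimpleGraph V} (hG : IsMN3P5 G) (S : Set V)
    (hS : S ≠ Set.univ) : ∃ c : V → Fin 3, ∀ x ∈ S, ∀ y ∈ S, G.Adj x y → c x ≠ c y := by
  classical
  have hne : (⊤ : G.Subgraph).induce S ≠ ⊤ := fun e => hS (by
    simpa using congrArg Subgraph.verts e)
  rcases hG.2.2 _ hne with ⟨⟨c⟩⟩ | hp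
  · let c' : S → Fin 3 := fun x => c x
    have hc' : ∀ x y : S, G.Adj x y → c' x ≠ c' y := fun x y hxy =>
      c.valid ⟨x.2, y.2, hxy⟩
    refine ⟨fun x => if hx : x ∈ S then c' ⟨x, hx⟩ else 0, fun x hx y hy hxy => ?_⟩
    simpa only [dif_pos hx, dif_pos hy] using hc' ⟨x, hx⟩ ⟨y, hy⟩ hxy
  · refine (hG.1 (hp.map ⟨⟨Subtype.val, Subtype.val_injective⟩, ?_⟩)).elim
    rintro ⟨x, hx⟩ ⟨y, hy⟩
    have hx' : x ∈ S := hx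
    have hy' : y ∈ S := hy
    simp [hx', hy']

theorem IsMN3P5.nonempty_iso {V W : Type*} {G : SimpleGraph V} {H : SimpleGraph W}
    (hG : IsMN3P5 G) (f : W → V) (hf : Function.Injective f)
    (hadj : ∀ x y, H.Adj x y → G.Adj (f x) (f y)) (hcol : ¬ H.Colorable 3) (hp : P5Free H) :
    Nonempty (H ≃g G) := by
  let K : G.Subgraph :=
    { verts := Set.range f
      Adj := fun a b => ∃ x y, H.Adj x y ∧ f x = a ∧ f y = b
      adj_sub := by
        rintro a b ⟨x, y, hxy, rfl, rfl⟩
        exact hadj x y hxy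
      edge_vert := by
        rintro a b ⟨x, y, hxy, rfl, rfl⟩
        exact ⟨x, rfl⟩
      symm := ⟨by
        rintro a b ⟨x, y, hxy, ha, hb⟩
        exact ⟨y, x, hxy.symm, hb, ha⟩⟩ }
  have hKadj : ∀ x y, K.Adj (f x) (f y) ↔ H.Adj x y := fun x y =>
    ⟨fun ⟨x', y', h, hx, hy⟩ => hf hx ▸ hf hy ▸ h, fun h => ⟨x, y, h, rfl, rfl⟩⟩
  let e : H ≃g K.coe := ⟨Equiv.ofInjective f hf, fun {x y} => hKadj x y⟩
  have htop : K = ⊤ := by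
    by_contra hne
    rcases hG.2.2 K hne with hc | hP
    · exact hcol (hc.of_hom e.toHom)
    · exact hp (hP.map e.symm.toEmbedding)
  have hverts : Set.range f = Set.univ := congrArg Subgraph.verts htop
  refine ⟨⟨Equiv.ofBijective f ⟨hf, Set.range_eq_univ.1 hverts⟩, fun {x y} => ?_⟩⟩
  rw [← hKadj, htop]
  rfl

theorem graphK4_not_colorable : ¬ graphK4.Colorable 3 := by
  rintro ⟨c⟩
  have : ∀ c : Fin 4 → Fin 3, ∃ i j, i ≠ j ∧ c i = c j := by decide
  obtain ⟨i, j, hij, e⟩ := this c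
  exact c.valid (show graphK4.Adj i j from hij) e

theorem graphK4_p5Free : P5Free graphK4 := by
  rintro ⟨f, -⟩
  simpa using Fintype.card_le_of_embedding f

instance : DecidableRel graphS1.Adj := fun a b =>
  decidable_of_iff (a ≠ b ∧ ((a, b) ∈ _ ∨ (b, a) ∈ _)) Iff.rfl

theorem graphS1_not_colorable : ¬ graphS1.Colorable 3 := by
  rintro ⟨c⟩
  have key : ∀ i j, graphS1.Adj i j → c i ≠ c j := fun i j hij => c.valid hij
  have h01 := key 0 1 (by decide)
  have h12 := key 1 2 (by decide)
  have h23 := key 2 3 (by decide)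
  have h34 := key 3 4 (by decide)
  have h40 := key 4 0 (by decide)
  have h50 := key 5 0 (by decide)
  have h51 := key 5 1 (by decide)
  have h52 := key 5 2 (by decide)
  have h60 := key 6 0 (by decide)
  have h63 := key 6 3 (by decide)
  have h64 := key 6 4 (by decide)
  omega

set_option synthInstance.maxHeartbeats 200000 in
set_option synthInstance.maxSize 1000 in
set_option maxRecDepth 10000 in
theorem graphS1_p5Free : P5Free graphS1 := by
  rintro ⟨f, hf⟩
  have key : ∀ a b : Fin 7, graphS1.Adj a b → ∀ c, graphS1.Adj b c → ¬ graphS1.Adj a c → a ≠ c →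
      ∀ d, graphS1.Adj c d → ¬ graphS1.Adj a d → ¬ graphS1.Adj b d → ∀ e, graphS1.Adj d e →
      ¬ graphS1.Adj a e → ¬ graphS1.Adj b e → graphS1.Adj c e := by decide
  have adj : ∀ i j : Fin 5, i.val + 1 = j.val → graphS1.Adj (f i) (f j) := fun i j h =>
    (hf i j).1 (pathGraph_adj.2 (Or.inl h))
  have nadj : ∀ i j : Fin 5, i.val + 1 < j.val → ¬ graphS1.Adj (f i) (f j) := fun i j h e => by
    have := pathGraph_adj.1 ((hf i j).2 e)
    omega
  exact nadj 2 4 (by decide) <| key (f 0) (f 1) (adj 0 1 (by decide)) (f 2) (adj 1 2 (by decide)) (nadj 0 2 (by decide))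
    (f.injective.ne (by decide)) (f 3) (adj 2 3 (by decide)) (nadj 0 3 (by decide))
    (nadj 1 3 (by decide)) (f 4) (adj 3 4 (by decide)) (nadj 0 4 (by decide))
    (nadj 1 4 (by decide))

theorem graphS1_isFiveHole : IsFiveHole graphS1 ![0, 1, 2, 3, 4] := by
  refine ⟨by decide, ?_⟩
  decide

theorem IsMN3P5.fiveHoleFreeCritical {V : Type*} {G : SimpleGraph V} (hG : IsMN3P5 G)
    (hK4 : ¬ Nonempty (G ≃g graphK4)) (hC5 : ¬ ∃ v : Fin 5 → V, IsFiveHole G v) :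
    FiveHoleFreeCritical G where
  p5 := fun a b c d e hab hbc hcd hde hac had hae hbd hbe hce =>
    hG.1 (.of_path hab hbc hcd hde hac had hae hbd hbe hce)
  c5 := by
    intro a b c d e hab hbc hcd hde hea hac had hbd hbe hce
    have key : ∀ i j : Fin 5, G.Adj (![a, b, c, d, e] i) (![a, b, c, d, e] j) ↔
        (j = i + 1 ∨ i = j + 1) := by
      intro i j
      fin_cases i <;> fin_cases j <;> simp [*, hea.symm, G.adj_comm]
    have twinfree : ∀ i j : Fin 5, (∀ k : Fin 5, (k = i + 1 ∨ i = k + 1) ↔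
        (k = j + 1 ∨ j = k + 1)) → i = j := by decide
    refine hC5 ⟨![a, b, c, d, e], fun i j hij => twinfree i j fun k => ?_, key⟩
    rw [← key, ← key, hij]
  k4 := by
    intro a b c d hab hac had hbc hbd hcd
    have key : ∀ i j : Fin 4, i ≠ j → G.Adj (![a, b, c, d] i) (![a, b, c, d] j) := by
      intro i j hij
      fin_cases i <;> fin_cases j <;> simp_all [G.adj_comm]
    obtain ⟨e⟩ := hG.nonempty_iso (H := graphK4) ![a, b, c, d]
      (fun i j hij => by_contra fun hne => (key i j hne).ne hij) key graphK4_not_colorable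
      graphK4_p5Free
    exact hK4 ⟨e.symm⟩
  spindle := by
    intro a b c d e f g hab hac hbc hbd hcd hae haf hef heg hfg hdg had hag hbe hbf hbg hce hcf hcg
      hde hdf
    have key : ∀ i j : Fin 7, graphS1.Adj i j →
        G.Adj (![a, b, d, g, e, c, f] i) (![a, b, d, g, e, c, f] j) := by
      simp [graphS1, graphOfList, Fin.forall_fin_succ, *, G.adj_comm]
    have nodup : (List.ofFn ![a, b, d, g, e, c, f]).Nodup := by
      have := hab.ne
      have := hac.ne
      have := hbc.ne
      have := hbd.ne
      have := hcd.ne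
      have := hae.ne
      have := haf.ne
      have := hef.ne
      have := heg.ne
      have := hfg.ne
      have := hdg.ne
      simp [List.ofFn_succ]
      grind
    obtain ⟨φ⟩ := hG.nonempty_iso (H := graphS1) ![a, b, d, g, e, c, f]
      (List.nodup_ofFn.1 nodup) key graphS1_not_colorable graphS1_p5Free
    exact hC5 ⟨φ ∘ ![0, 1, 2, 3, 4], φ.injective.comp graphS1_isFiveHole.1, fun i j =>
      φ.map_adj_iff.trans (graphS1_isFiveHole.2 i j)⟩
  critical := hG.exists_coloring_on
  not_colorable := by
    intro c
    by_contra! hc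
    exact hG.2.1 ⟨Coloring.mk c fun {x y} hxy => hc x y hxy⟩

theorem mn3p5_not_k4_has_five_hole
    {V : Type*} [Fintype V] (G : SimpleGraph V) (hG : IsMN3P5 G)
    (hK4 : ¬ Nonempty (G ≃g graphK4)) :
    ∃ v : Fin 5 → V, IsFiveHole G v := by
  by_contra hC5
  exact (hG.fiveHoleFreeCritical hK4 hC5).false
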